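/- If a relation R on ℤ is definable in ⟨ℤ, '⟩ (the integers with the successor relation) and R is not identically true and not identically false, then there is a natural number n such that R ≈ A_n, or R ≈ B_n, or R ≈ C_n. -/

import Mathlib

open FirstOrder Language

/-- Language with relation symbols indexed by `ι`, where symbol `i` has arity `ar i`. -/
def multiRelLang {ι : Type} (ar : ι → ℕ) : FirstOrder.Language where
  Functions _ := Empty
  Relations m := { i : ι // ar i = m }

/-- The structure on `M` interpreting symbol `i` as the relation `Rels i`. -/
def multiRelStructure {M : Type*} {ι : Type} {ar : ι → ℕ}
    (Rels : ∀ i, (Fin (ar i) → M) → Prop) : (multiRelLang ar).Structure M where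
  funMap f := f.elim
  RelMap r x := Rels r.1 fun j => x (Fin.cast r.2 j)

/-- Language with one relation symbol, of arity `n`. -/
def relLang (n : ℕ) : FirstOrder.Language := multiRelLang (fun _ : Unit => n)

/-- `R` is definable, without parameters, by a first-order formula in the language with a
single relation symbol interpreted as `Q`. -/
def DefinableBy {M : Type*} {n k : ℕ} (Q : (Fin n → M) → Prop)
    (R : (Fin k → M) → Prop) : Prop :=
  letI : (relLang n).Structure M := multiRelStructure (fun _ : Unit => Q)
  ∃ φ : (relLang n).Formula (Fin k), ∀ v : Fin k → M, R v ↔ φ.Realize v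

/-- The successor relation on `ℤ` : `v 1 = v 0 + 1`. -/
def succZ : (Fin 2 → ℤ) → Prop := fun v => v 1 = v 0 + 1

/-- The binary relation `A_n` : `x₁ − x₂ = n` on `ℤ`. -/
def AZ (n : ℕ) : (Fin 2 → ℤ) → Prop := fun v => v 0 - v 1 = (n : ℤ)

/-- The 4-ary relation `B_n` :
`(x₁ − x₂ = n ∧ x₃ − x₄ = n) ∨ (x₁ − x₂ = −n ∧ x₃ − x₄ = −n)` on `ℤ`. -/
def BZ (n : ℕ) : (Fin 4 → ℤ) → Prop := fun v =>
  (v 0 - v 1 = (n : ℤ) ∧ v 2 - v 3 = (n : ℤ)) ∨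
  (v 0 - v 1 = -(n : ℤ) ∧ v 2 - v 3 = -(n : ℤ))

/-- The binary relation `C_n` : `|x₁ − x₂| = n` on `ℤ`. -/
def CZ (n : ℕ) : (Fin 2 → ℤ) → Prop := fun v => |v 0 - v 1| = (n : ℤ)

/-- `Q ≈ R` : the relations `Q` and `R` define each other. -/
def DefEquiv {M : Type*} {n k : ℕ} (Q : (Fin n → M) → Prop)
    (R : (Fin k → M) → Prop) : Prop :=
  DefinableBy Q R ∧ DefinableBy R Q
/-! ### Closure properties of definability -/

/-- The structure on `ℤ` given by a single relation. -/
def relStructure {q : ℕ} (Q : (Fin q → ℤ) → Prop) : (relLang q).Structure ℤ :=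
  multiRelStructure (fun _ : Unit => Q)

/-- `s` is definable from `Q`, where the free variables may be indexed by any type. -/
def DefBy {q : ℕ} (Q : (Fin q → ℤ) → Prop) {α : Type} (s : (α → ℤ) → Prop) : Prop :=
  letI : (relLang q).Structure ℤ := relStructure Q
  ∃ φ : (relLang q).Formula α, ∀ v : α → ℤ, s v ↔ φ.Realize v

namespace DefBy

variable {q : ℕ} {Q : (Fin q → ℤ) → Prop} {α β ι : Type} {s t : (α → ℤ) → Prop}

theorem congr (h : DefBy Q s) (hst : ∀ v, s v ↔ t v) : DefBy Q t := by
  obtain ⟨φ, hφ⟩ := h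
  exact ⟨φ, fun v => (hst v).symm.trans (hφ v)⟩

theorem neg (h : DefBy Q s) : DefBy Q (fun v => ¬ s v) := by
  let _ : (relLang q).Structure ℤ := relStructure Q
  obtain ⟨φ, hφ⟩ := h
  exact ⟨φ.not, fun v => by simp only [Formula.realize_not, hφ]⟩

theorem and (hs : DefBy Q s) (ht : DefBy Q t) : DefBy Q (fun v => s v ∧ t v) := by
  let _ : (relLang q).Structure ℤ := relStructure Q
  obtain ⟨φ, hφ⟩ := hs
  obtain ⟨ψ, hψ⟩ := ht
  exact ⟨φ ⊓ ψ, fun v => by simp only [Formula.realize_inf, hφ, hψ]⟩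

theorem or (hs : DefBy Q s) (ht : DefBy Q t) : DefBy Q (fun v => s v ∨ t v) :=
  (hs.neg.and ht.neg).neg.congr fun v => by tauto

theorem imp (hs : DefBy Q s) (ht : DefBy Q t) : DefBy Q (fun v => s v → t v) :=
  (hs.and ht.neg).neg.congr fun v => by tauto

theorem iff (hs : DefBy Q s) (ht : DefBy Q t) : DefBy Q (fun v => s v ↔ t v) :=
  ((hs.imp ht).and (ht.imp hs)).congr fun v => by tauto

theorem const (p : Prop) : DefBy Q (fun _ : α → ℤ => p) := by
  let _ : (relLang q).Structure ℤ := relStructure Q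
  by_cases hp : p
  · exact ⟨⊤, fun v => by simp [hp]⟩
  · exact ⟨⊥, fun v => by simp [hp]⟩

theorem all_index [Finite ι] {s : ι → (α → ℤ) → Prop} (h : ∀ i, DefBy Q (s i)) :
    DefBy Q (fun v => ∀ i, s i v) := by
  let _ : (relLang q).Structure ℤ := relStructure Q
  choose φ hφ using h
  exact ⟨Formula.iInf φ, fun v => by simp only [Formula.realize_iInf, hφ]⟩

theorem ex_index [Finite ι] {s : ι → (α → ℤ) → Prop} (h : ∀ i, DefBy Q (s i)) :
    DefBy Q (fun v => ∃ i, s i v) :=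
  (all_index fun i => (h i).neg).neg.congr fun v => by simp

theorem comp (h : DefBy Q s) (f : α → β) : DefBy Q (fun v : β → ℤ => s (fun i => v (f i))) := by
  let _ : (relLang q).Structure ℤ := relStructure Q
  obtain ⟨φ, hφ⟩ := h
  exact ⟨φ.relabel f, fun v => by
    simp only [Formula.realize_relabel, hφ]
    rfl⟩

theorem comp₂ {T : ℤ → ℤ → Prop} (h : DefBy Q (fun v : Fin 2 → ℤ => T (v 0) (v 1))) (i j : α) :
    DefBy Q (fun v : α → ℤ => T (v i) (v j)) :=
  h.comp ![i, j]

theorem comp₄ {T : ℤ → ℤ → ℤ → ℤ → Prop}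
    (h : DefBy Q (fun v : Fin 4 → ℤ => T (v 0) (v 1) (v 2) (v 3))) (i j k l : α) :
    DefBy Q (fun v : α → ℤ => T (v i) (v j) (v k) (v l)) :=
  h.comp ![i, j, k, l]

theorem ex [Finite β] {s : (α → ℤ) → (β → ℤ) → Prop}
    (h : DefBy Q (fun u : α ⊕ β → ℤ => s (fun i => u (.inl i)) (fun j => u (.inr j)))) :
    DefBy Q (fun v => ∃ w, s v w) := by
  let _ : (relLang q).Structure ℤ := relStructure Q
  obtain ⟨φ, hφ⟩ := h
  refine ⟨φ.iExs β, fun v => ?_⟩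
  rw [Formula.realize_iExs]
  exact exists_congr fun w => hφ (Sum.elim v w)

theorem all [Finite β] {s : (α → ℤ) → (β → ℤ) → Prop}
    (h : DefBy Q (fun u : α ⊕ β → ℤ => s (fun i => u (.inl i)) (fun j => u (.inr j)))) :
    DefBy Q (fun v => ∀ w, s v w) :=
  (ex (s := fun v w => ¬ s v w) h.neg).neg.congr fun v => by simp

theorem ex₁ {s : (α → ℤ) → ℤ → Prop}
    (h : DefBy Q (fun u : α ⊕ Unit → ℤ => s (fun i => u (.inl i)) (u (.inr ())))) :
    DefBy Q (fun v => ∃ z, s v z) :=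
  (ex (s := fun v w => s v (w ())) h).congr fun _ =>
    ⟨fun ⟨w, hw⟩ => ⟨w (), hw⟩, fun ⟨z, hz⟩ => ⟨fun _ => z, hz⟩⟩

theorem eq (i j : α) : DefBy Q (fun v : α → ℤ => v i = v j) := by
  let _ : (relLang q).Structure ℤ := relStructure Q
  exact ⟨(Term.var i).equal (Term.var j), fun v => by simp [Formula.realize_equal]⟩

theorem self : DefBy Q Q := by
  let _ : (relLang q).Structure ℤ := relStructure Q
  let r : (relLang q).Relations q := ⟨(), rfl⟩
  refine ⟨r.formula fun i => Term.var i, fun v => ?_⟩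
  rw [Formula.realize_rel]
  rfl

/-- A relation whose truth is determined by finitely many definable relations is definable. -/
theorem of_finite [Finite ι] {e : ι → (α → ℤ) → Prop} (h : ∀ i, DefBy Q (e i))
    (hs : ∀ x y, (∀ i, e i x ↔ e i y) → s x → s y) : DefBy Q s := by
  have key : DefBy Q (fun x => ∃ τ : Set ι, (∃ y, s y ∧ ∀ i, i ∈ τ ↔ e i y) ∧
      ∀ i, (i ∈ τ ↔ e i x)) :=
    ex_index fun τ => (const _).and (all_index fun i => (const _).iff (h i))
  refine key.congr fun x => ⟨?_, fun hx =>
    ⟨{i | e i x}, ⟨x, hx, fun i => Iff.rfl⟩, fun i => Iff.rfl⟩⟩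
  rintro ⟨τ, ⟨y, hy, hτ⟩, hx⟩
  exact hs y x (fun i => (hτ i).symm.trans (hx i)) hy

end DefBy

/-! ### Locality -/

/-- `x` and `y` have the same coordinate differences, differences above `N` being identified. -/
def Sim {α : Type} (N : ℕ) (x y : α → ℤ) : Prop :=
  ∀ i j, x i - x j = y i - y j ∨ ((N : ℤ) < |x i - x j| ∧ (N : ℤ) < |y i - y j|)

theorem Sim.symm {α : Type} {N : ℕ} {x y : α → ℤ} (h : Sim N x y) : Sim N y x := fun i j =>
  (h i j).imp Eq.symm And.symm

theorem Sim.mono {α : Type} {M N : ℕ} (hMN : M ≤ N) {x y : α → ℤ} (h : Sim N x y) : Sim M x y :=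
  fun i j => (h i j).imp id fun h => ⟨by omega, by omega⟩

theorem Sim.exists_extend {α : Type} [Finite α] {N : ℕ} {x y : α → ℤ} (h : Sim (2 * N) x y)
    (a : ℤ) : ∃ b, ∀ i, x i - a = y i - b ∨ ((N : ℤ) < |x i - a| ∧ (N : ℤ) < |y i - b|) := by
  by_cases hi : ∃ i, |x i - a| ≤ N
  · obtain ⟨i, hi⟩ := hi
    refine ⟨y i + (a - x i), fun j => ?_⟩
    rcases h i j with hj | hj
    · left; omega
    · right; push_cast at hj; grind
  · obtain ⟨b, hb⟩ := (Set.finite_range y).bddAbove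
    refine ⟨b + N + 1, fun i => Or.inr ⟨by simpa using not_exists.1 hi i, ?_⟩⟩
    have := hb ⟨i, rfl⟩
    rw [lt_abs]; omega

/-- Truth depends only on the coordinate differences up to some bound. -/
def LocalRel {α : Type} (s : (α → ℤ) → Prop) : Prop :=
  ∃ N : ℕ, ∀ x y, Sim N x y → s x → s y

theorem DefBy.localRel {q : ℕ} {Q : (Fin q → ℤ) → Prop} (hQ : LocalRel Q) {α : Type} [Finite α]
    {s : (α → ℤ) → Prop} (h : DefBy Q s) : LocalRel s := by
  let _ : (relLang q).Structure ℤ := relStructure Q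
  have term_var : ∀ {γ : Type} (t : (relLang q).Term γ), ∃ i, t = Term.var i := by
    intro γ t
    cases t with
    | var i => exact ⟨i, rfl⟩
    | func f _ => exact f.elim
  have key : ∀ {m : ℕ} (φ : (relLang q).BoundedFormula α m), ∃ N : ℕ, ∀ x y : α ⊕ Fin m → ℤ,
      Sim N x y → φ.Realize (x ∘ Sum.inl) (x ∘ Sum.inr) →
        φ.Realize (y ∘ Sum.inl) (y ∘ Sum.inr) := by
    intro m φ
    induction φ with
    | falsum => exact ⟨0, fun _ _ _ h => h⟩
    | equal t₁ t₂ =>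
      obtain ⟨i, rfl⟩ := term_var t₁
      obtain ⟨j, rfl⟩ := term_var t₂
      refine ⟨0, fun x y hxy hx => ?_⟩
      have hx' : x i = x j := by simpa [BoundedFormula.Realize] using hx
      have hy' : y i = y j := by
        have := hxy i j
        simp only [hx', sub_self, abs_zero] at this
        simp only [Nat.cast_zero, abs_pos] at this; omega
      simpa [BoundedFormula.Realize] using hy'
    | rel r ts =>
      obtain ⟨r, rfl⟩ := r
      choose f hf using fun i => term_var (ts i)
      obtain ⟨N, hN⟩ := hQ
      refine ⟨N, fun x y hxy hx => ?_⟩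
      obtain rfl : ts = fun i => Term.var (f i) := funext hf
      have hx' : Q fun i => x (f i) := by
        have : Q fun i => Sum.elim (x ∘ Sum.inl) (x ∘ Sum.inr) (f i) := hx
        simpa using this
      have hy' : Q fun i => y (f i) := hN _ _ (fun i j => hxy (f i) (f j)) hx'
      have : Q fun i => Sum.elim (y ∘ Sum.inl) (y ∘ Sum.inr) (f i) := by simpa using hy'
      exact this
    | imp φ ψ ihφ ihψ =>
      obtain ⟨N₁, h₁⟩ := ihφ
      obtain ⟨N₂, h₂⟩ := ihψ
      refine ⟨max N₁ N₂, fun x y hxy hx hy => ?_⟩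
      exact h₂ x y (hxy.mono (le_max_right _ _)) (hx (h₁ y x (hxy.mono (le_max_left _ _)).symm hy))
    | @all m φ ih =>
      obtain ⟨N, hN⟩ := ih
      refine ⟨2 * N, fun x y hxy hx b => ?_⟩
      obtain ⟨a, ha⟩ := hxy.symm.exists_extend b
      have := hN (Sum.elim (x ∘ Sum.inl) (Fin.snoc (x ∘ Sum.inr) a))
        (Sum.elim (y ∘ Sum.inl) (Fin.snoc (y ∘ Sum.inr) b)) ?_ (hx a)
      · exact this
      have hmono := hxy.mono (show N ≤ 2 * N by omega)
      have ha' : ∀ i, x i - a = y i - b ∨ ((N : ℤ) < |x i - a| ∧ (N : ℤ) < |y i - b|) :=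
        fun i => (ha i).imp Eq.symm And.symm
      have ha'' : ∀ i, a - x i = b - y i ∨ ((N : ℤ) < |a - x i| ∧ (N : ℤ) < |b - y i|) :=
        fun i => by rw [abs_sub_comm a, abs_sub_comm b]; exact (ha' i).imp (by omega) id
      rintro (i | i) (j | j) <;> try induction i using Fin.lastCases
      all_goals try induction j using Fin.lastCases
      all_goals simp [hmono _ _, ha' _, ha'' _]
  obtain ⟨φ, hφ⟩ := h
  obtain ⟨N, hN⟩ := key φ
  refine ⟨N, fun x y hxy hx => ?_⟩
  have := hN (Sum.elim x Fin.elim0) (Sum.elim y Fin.elim0) (by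
    rintro (i | i) (j | j)
    · exact hxy i j
    · exact j.elim0
    · exact i.elim0
    · exact i.elim0)
  have hr : ∀ z : α → ℤ, φ.Realize z ↔ BoundedFormula.Realize φ (Sum.elim z Fin.elim0 ∘ Sum.inl)
      (Sum.elim z Fin.elim0 ∘ Sum.inr) := fun z => by
    rw [Formula.Realize, Sum.elim_comp_inl]
    exact iff_of_eq (congrArg _ (Subsingleton.elim _ _))
  exact (hφ y).2 ((hr y).2 (this ((hr x).1 ((hφ x).1 hx))))

/-! ### Distances from finite difference sets -/

/-- `z` is a walk from `x` to `y` with steps in `S`. -/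
def IsStepWalk (S : Set ℤ) {m : ℕ} (z : Fin (m + 1) → ℤ) (x y : ℤ) : Prop :=
  z 0 = x ∧ z (Fin.last m) = y ∧ ∀ i : Fin m, z i.succ - z i.castSucc ∈ S

theorem IsStepWalk.eq_of_extremal {S : Set ℤ} {m : ℕ} (hle : ∀ s ∈ S, |s| ≤ m) {e x : ℤ}
    (hm : 0 < m) (he : |e| = m) {z : Fin (m + 1) → ℤ} (hz : IsStepWalk S z x (x + m * e))
    (i : Fin (m + 1)) : z i = x + i * e := by
  have hee : e * e = (m : ℤ) * m := by rw [← he, abs_mul_abs_self]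
  have hanti : Antitone fun i : Fin (m + 1) => e * z i - i * (e * e) := by
    refine Fin.antitone_iff_succ_le.2 fun i => ?_
    have h1 := hle _ (hz.2.2 i)
    have h2 : e * (z i.succ - z i.castSucc) ≤ e * e := by
      rw [hee]
      calc _ ≤ |e * (z i.succ - z i.castSucc)| := le_abs_self _
        _ = m * |z i.succ - z i.castSucc| := by rw [abs_mul, he]
        _ ≤ m * m := by gcongr
    simp only [Fin.val_succ, Fin.val_castSucc]
    push_cast
    linarith
  have h0 := hanti (Fin.zero_le i)
  have h1 := hanti (Fin.le_last i)
  simp only [hz.1, hz.2.1, Fin.val_zero, Fin.val_last, Nat.cast_zero] at h0 h1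
  have he0 : e ≠ 0 := by rintro rfl; simp at he; omega
  apply mul_left_cancel₀ he0
  linarith

theorem IsStepWalk.step_eq_of_unique {S : Set ℤ} {m : ℕ} (hm : 0 < m)
    {x y : ℤ} {z : Fin (m + 1) → ℤ}
    (hz : IsStepWalk S z x y) (huniq : ∀ z', IsStepWalk S z' x y → ∀ i, z' i = z i) :
    ∃ s, ∀ i : Fin (m + 1), z i = x + i * s := by
  have step : ∀ i (hi : i + 2 < m + 1),
      z ⟨i + 2, hi⟩ - z ⟨i + 1, by omega⟩ = z ⟨i + 1, by omega⟩ - z ⟨i, by omega⟩ := by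
    intro i hi
    have := huniq (Function.update z ⟨i + 1, by omega⟩
      (z ⟨i, by omega⟩ + z ⟨i + 2, hi⟩ - z ⟨i + 1, by omega⟩)) ?_ ⟨i + 1, by omega⟩
    · rw [Function.update_self] at this
      omega
    refine ⟨?_, ?_, ?_⟩
    · rw [Function.update_of_ne (by simp [Fin.ext_iff]), hz.1]
    · rw [Function.update_of_ne (by simp [Fin.ext_iff]; omega), hz.2.1]
    · intro j
      have h1 := hz.2.2 ⟨i, by omega⟩
      have h2 := hz.2.2 ⟨i + 1, by omega⟩
      have h3 := hz.2.2 j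
      simp only [Fin.succ_mk, Fin.castSucc_mk] at h1 h2
      simp only [Function.update_apply, Fin.ext_iff, Fin.val_succ, Fin.val_castSucc]
      by_cases hj : (j : ℕ) = i
      · subst hj
        rw [if_pos rfl, if_neg (by omega)]
        convert h2 using 1
        change _ + _ - _ - z ⟨j, _⟩ = _
        ring
      · by_cases hj' : (j : ℕ) = i + 1
        · obtain ⟨j, hjm⟩ := j
          subst hj'
          rw [if_neg (by simp), if_pos rfl]
          convert h1 using 1
          change z ⟨i + 2, _⟩ - _ = _
          ring
        · simpa [hj, hj'] using h3
  refine ⟨z ⟨1, by omega⟩ - x, ?_⟩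
  have h0 : z ⟨0, by omega⟩ = x := hz.1
  have key : ∀ i (hi : i + 1 < m + 1), z ⟨i + 1, hi⟩ - z ⟨i, by omega⟩ = z ⟨1, by omega⟩ - x ∧
      z ⟨i, by omega⟩ = x + i * (z ⟨1, by omega⟩ - x) := by
    intro i
    induction i with
    | zero => exact fun hi => ⟨by rw [h0], by rw [h0]; simp⟩
    | succ i ih =>
      intro hi
      obtain ⟨h1, h2⟩ := ih (by omega)
      refine ⟨(step i (by omega)).trans h1, ?_⟩
      push_cast
      linarith
  intro i
  obtain ⟨i, hi⟩ := i
  rcases Nat.eq_zero_or_pos i with rfl | h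
  · rw [h0]; simp
  · obtain ⟨h1, h2⟩ := key (i - 1) (by omega)
    have : z ⟨i - 1 + 1, by omega⟩ = z ⟨i, hi⟩ := by congr; omega
    rw [this] at h1
    push_cast [Nat.cast_sub h] at h2
    simp only
    linarith

theorem abs_sub_eq_iff_unique_walk {S : Set ℤ} {m : ℕ} (hm : 0 < m) (hneg : ∀ s ∈ S, -s ∈ S)
    (h0 : 0 ∈ S) (hmS : (m : ℤ) ∈ S) (hle : ∀ s ∈ S, |s| ≤ m) (x x' : ℤ) :
    |x - x'| = m ↔ ∃ y, y ≠ x ∧ ∃ z : Fin (m + 1) → ℤ, IsStepWalk S z x y ∧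
      z ⟨1, by omega⟩ = x' ∧ ∀ z' : Fin (m + 1) → ℤ, IsStepWalk S z' x y → ∀ i, z' i = z i := by
  constructor
  · intro h
    have he : |x' - x| = m := by rw [abs_sub_comm, h]
    have heS : x' - x ∈ S := by
      rcases abs_eq_abs.1 (he.trans (Nat.abs_cast m).symm) with h | h <;> rw [h]
      · exact hmS
      · exact hneg _ hmS
    refine ⟨x + m * (x' - x), ?_, fun i => x + i * (x' - x), ⟨by simp, by simp, fun i => ?_⟩,
      by simp, fun z' hz' i => hz'.eq_of_extremal hle hm he i⟩
    · have : (m : ℤ) * (x' - x) ≠ 0 := mul_ne_zero (by omega) (by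
        intro h; rw [h] at he; simp at he; omega)
      omega
    · convert heS using 1
      simp only [Fin.val_succ, Fin.val_castSucc]
      push_cast
      ring
  · rintro ⟨y, hy, z, hz, rfl, huniq⟩
    obtain ⟨s, hs⟩ := hz.step_eq_of_unique hm huniq
    have hz1 : z ⟨1, by omega⟩ = x + s := by rw [hs]; simp
    have hy' : y = x + m * s := by rw [← hz.2.1, hs]; simp
    have hsS : s ∈ S := by
      have := hz.2.2 ⟨0, hm⟩
      simpa [hs] using this
    have hs0 : s ≠ 0 := by rintro rfl; simp at hy'; exact hy hy'
    have hsle := hle s hsS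
    rw [hz1, sub_add_cancel_left, abs_neg]
    by_contra hne
    have hsgn : s.sign * m ∈ S := by
      rcases lt_or_gt_of_ne hs0 with h | h
      · rw [Int.sign_eq_neg_one_of_neg h, neg_one_mul]; exact hneg _ hmS
      · rw [Int.sign_eq_one_of_pos h, one_mul]; exact hmS
    have hpos : 0 < |s| := abs_pos.2 hs0
    have := huniq (fun i => x + min (i : ℤ) |s| * (s.sign * m)) ⟨?_, ?_, ?_⟩ ⟨1, by omega⟩
    · rw [hz1] at this
      simp only [Nat.cast_one] at this
      rw [min_eq_left (by omega), one_mul, add_right_inj] at this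
      apply hne
      rw [← this, abs_mul, Int.abs_sign_of_ne_zero hs0]
      simp
    · simp [hpos.le]
    · simp only [Fin.val_last]
      rw [min_eq_right hsle, ← mul_assoc, mul_comm |s|, Int.sign_mul_abs, hy', mul_comm s]
    · intro i
      simp only [Fin.val_succ, Fin.val_castSucc]
      push_cast
      rcases lt_or_ge (i : ℤ) |s| with h | h
      · rw [min_eq_left (by omega), min_eq_left h.le]
        convert hsgn using 1
        ring
      · rw [min_eq_right (by omega), min_eq_right h]
        simpa using h0

theorem DefBy.isStepWalk {q : ℕ} {Q : (Fin q → ℤ) → Prop} {α : Type} {S : Set ℤ}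
    (hS : DefBy Q fun v : Fin 2 → ℤ => v 0 - v 1 ∈ S) {m : ℕ} (f : Fin (m + 1) → α) (i j : α) :
    DefBy Q fun v : α → ℤ => IsStepWalk S (fun l => v (f l)) (v i) (v j) :=
  (DefBy.eq _ _).and ((DefBy.eq _ _).and (DefBy.all_index fun l =>
    hS.comp₂ (T := fun a b => a - b ∈ S) (f l.succ) (f l.castSucc)))

theorem DefBy.abs_sub_of_max {q : ℕ} {Q : (Fin q → ℤ) → Prop} {S : Set ℤ}
    (hS : DefBy Q fun v : Fin 2 → ℤ => v 0 - v 1 ∈ S) {m : ℕ} (hneg : ∀ s ∈ S, -s ∈ S)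
    (hmS : (m : ℤ) ∈ S) (hle : ∀ s ∈ S, |s| ≤ m) :
    DefBy Q fun v : Fin 2 → ℤ => |v 0 - v 1| = m := by
  rcases Nat.eq_zero_or_pos m with rfl | hm
  · exact (DefBy.eq 0 1).congr fun v => by simp [sub_eq_zero]
  have hS' : DefBy Q fun v : Fin 2 → ℤ => v 0 - v 1 ∈ insert 0 S :=
    ((DefBy.eq 0 1).or hS).congr fun v => by simp [sub_eq_zero]
  refine DefBy.congr ?_ fun v => (abs_sub_eq_iff_unique_walk (S := insert 0 S) hm
    (by simpa using fun s hs => Or.inr (hneg s hs)) (by simp) (by simp [hmS])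
    (by simpa using hle) (v 0) (v 1)).symm
  refine DefBy.ex₁ ((DefBy.eq _ _).neg.and (DefBy.ex (DefBy.and ?_ (DefBy.and (DefBy.eq _ _)
    (DefBy.all (DefBy.imp ?_ (DefBy.all_index fun i => DefBy.eq _ _)))))))
  · exact hS'.isStepWalk _ _ _
  · exact hS'.isStepWalk _ _ _

theorem DefBy.abs_sub_of_finite {q : ℕ} {Q : (Fin q → ℤ) → Prop} (S : Finset ℤ)
    (hS : DefBy Q fun v : Fin 2 → ℤ => v 0 - v 1 ∈ S) (hneg : ∀ s ∈ S, -s ∈ S) {d : ℤ}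
    (hd : d ∈ S) : DefBy Q fun v : Fin 2 → ℤ => |v 0 - v 1| = |d| := by
  induction hn : S.card using Nat.strong_induction_on generalizing S with
  | _ n ih =>
    obtain ⟨m, hm, hle⟩ := S.exists_max_image (fun s => |s|) ⟨d, hd⟩
    have hmax : DefBy Q fun v : Fin 2 → ℤ => |v 0 - v 1| = |m| := by
      have := DefBy.abs_sub_of_max (S := S) (m := m.natAbs) hS hneg
        (by rcases abs_choice m with h | h <;> simp [h, hm, hneg m hm])
        (by simpa using hle)
      simpa using this
    by_cases hdm : |d| = |m|
    · rwa [hdm]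
    refine ih _ ?_ (S.filter fun s => ¬ |s| = |m|) ?_ ?_ (by simp [hd, hdm]) rfl
    · rw [← hn]
      exact Finset.card_lt_card (Finset.filter_ssubset.2 ⟨m, hm, by simp⟩)
    · exact (hS.and hmax.neg).congr fun v => by simp
    · intro s hs
      simp only [Finset.mem_filter, abs_neg] at hs ⊢
      exact ⟨hneg s hs.1, hs.2⟩

/-- The differences `d` such that some definable relation `x - y ∈ S` has `d ∈ S` and `S` finite. -/
def algDiff {q : ℕ} (Q : (Fin q → ℤ) → Prop) : AddSubgroup ℤ where
  carrier := {d | ∃ S : Finset ℤ, d ∈ S ∧ DefBy Q fun v : Fin 2 → ℤ => v 0 - v 1 ∈ S}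
  zero_mem' := ⟨{0}, by simp, (DefBy.eq 0 1).congr fun v => by simp [sub_eq_zero]⟩
  add_mem' := by
    rintro a b ⟨S, ha, hS⟩ ⟨T, hb, hT⟩
    refine ⟨(S ×ˢ T).image fun p => p.1 + p.2, Finset.mem_image.2 ⟨(a, b), by simp [ha, hb]⟩, ?_⟩
    have : DefBy Q fun v : Fin 2 → ℤ => ∃ z, v 0 - z ∈ S ∧ z - v 1 ∈ T :=
      DefBy.ex₁ ((hS.comp₂ (T := fun a b => a - b ∈ S) _ _).and
        (hT.comp₂ (T := fun a b => a - b ∈ T) _ _))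
    refine this.congr fun v => ?_
    simp only [Finset.mem_image, Finset.mem_product, Prod.exists]
    constructor
    · rintro ⟨z, h1, h2⟩
      exact ⟨_, _, ⟨h1, h2⟩, by omega⟩
    · rintro ⟨s, t, ⟨hs, ht⟩, h⟩
      exact ⟨v 1 + t, by convert hs using 1; omega, by convert ht using 1; omega⟩
  neg_mem' := by
    rintro a ⟨S, ha, hS⟩
    refine ⟨S.image Neg.neg, Finset.mem_image.2 ⟨a, ha, rfl⟩, ?_⟩
    refine (hS.comp₂ (T := fun a b => a - b ∈ S) 1 0).congr fun v => ?_
    simp only [Finset.mem_image]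
    exact ⟨fun h => ⟨_, h, by omega⟩, fun ⟨s, hs, h⟩ => by convert hs using 1; omega⟩

theorem DefBy.abs_sub_of_mem_algDiff {q : ℕ} {Q : (Fin q → ℤ) → Prop} {d : ℤ}
    (hd : d ∈ algDiff Q) : DefBy Q fun v : Fin 2 → ℤ => |v 0 - v 1| = |d| := by
  obtain ⟨S, hdS, hS⟩ := hd
  refine DefBy.abs_sub_of_finite (S ∪ S.image Neg.neg) ?_ ?_ (Finset.mem_union_left _ hdS)
  · refine (hS.or (hS.comp₂ (T := fun a b => a - b ∈ S) 1 0)).congr fun v => ?_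
    rw [Finset.mem_union, Finset.mem_image]
    refine or_congr Iff.rfl ⟨fun h => ⟨_, h, by omega⟩, ?_⟩
    rintro ⟨s, hs, h⟩
    convert hs using 1
    omega
  · intro s
    simp only [Finset.mem_union, Finset.mem_image, Int.neg_inj]
    rintro (h | ⟨t, ht, rfl⟩)
    · exact Or.inr ⟨s, h, rfl⟩
    · exact Or.inl (by simpa using ht)

theorem mem_algDiff_of_abs_sub {q : ℕ} {Q : (Fin q → ℤ) → Prop} {d : ℤ}
    (h : DefBy Q fun v : Fin 2 → ℤ => |v 0 - v 1| = |d|) : d ∈ algDiff Q :=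
  ⟨{d, -d}, by simp, h.congr fun v => by simp [abs_eq_abs]⟩

/-! ### Degeneracy of algebraic dependence -/

theorem exists_abs_le {α : Type} [Finite α] (f : α → ℤ) : ∃ M : ℕ, ∀ i, |f i| ≤ M := by
  obtain ⟨M, hM⟩ := (Set.finite_range fun i => (f i).natAbs).bddAbove
  refine ⟨M, fun i => ?_⟩
  have := hM ⟨i, rfl⟩
  rw [Int.abs_eq_natAbs]
  exact_mod_cast this

theorem LocalRel.exists_on {α : Type} {X : (α → ℤ) → Prop} {N : ℕ}
    (hN : ∀ x y, Sim N x y → X x → X y) {U : Set α}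
    (hdep : ∀ x y, (∀ i ∈ U, x i = y i) → X x → X y) {x y : α → ℤ}
    (h : ∀ i ∈ U, ∀ j ∈ U, x i - x j = y i - y j ∨ ((N : ℤ) < |x i - x j| ∧ (N : ℤ) < |y i - y j|))
    (hx : X x) : X y := by
  classical
  by_cases hU : ∃ a, a ∈ U
  · obtain ⟨a, ha⟩ := hU
    have e : ∀ i, ∃ i' ∈ U, i ∈ U → i' = i := fun i => by
      by_cases hi : i ∈ U
      · exact ⟨i, hi, fun _ => rfl⟩
      · exact ⟨a, ha, fun h => absurd h hi⟩
    choose e he he' using e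
    refine hdep (fun i => y (e i)) y (fun i hi => by simp [he' i hi]) ?_
    refine hN (fun i => x (e i)) _ (fun i j => h _ (he i) _ (he j)) ?_
    exact hdep x _ (fun i hi => by simp [he' i hi]) hx
  · exact hdep x y (fun i hi => absurd ⟨i, hi⟩ hU) hx

/-- The coordinates in `J` can be changed so as to keep `X` true and avoid any `L` given values. -/
def Movable {α : Type} (J : Set α) (L : ℕ) (X : (α → ℤ) → Prop) (x : α → ℤ) : Prop :=
  ∀ w : Fin L → ℤ, ∃ y, (∀ i, i ∉ J → y i = x i) ∧ X y ∧ ∀ j, j ∈ J → ∀ l, y j ≠ w l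

theorem DefBy.movable {q : ℕ} {Q : (Fin q → ℤ) → Prop} {α : Type} [Finite α]
    {X : (α → ℤ) → (α → ℤ) → Prop}
    (hX : DefBy Q fun u : α ⊕ α → ℤ => X (fun i => u (.inl i)) (fun i => u (.inr i)))
    (J : Set α) (L : ℕ) : DefBy Q fun x => Movable J L (X x) x := by
  refine DefBy.all (DefBy.ex (DefBy.and ?_ (DefBy.and ?_ ?_)))
  · exact DefBy.all_index fun i => (DefBy.const _).imp (DefBy.eq _ _)
  · exact hX.comp (Sum.elim (fun i => Sum.inl (Sum.inl i)) Sum.inr)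
  · exact DefBy.all_index fun j => (DefBy.const _).imp (DefBy.all_index fun l => (DefBy.eq _ _).neg)

theorem Movable.exists_avoid {α : Type} {J : Set α} {L : ℕ} {X : (α → ℤ) → Prop} {x : α → ℤ}
    (h : Movable J L X x) (W : Finset ℤ) (hW : W.card ≤ L) :
    ∃ y, (∀ i ∉ J, y i = x i) ∧ X y ∧ ∀ j ∈ J, y j ∉ W := by
  obtain ⟨y, h1, h2, h3⟩ := h fun l => if hl : l < W.card then W.equivFin.symm ⟨l, hl⟩ else 0
  refine ⟨y, h1, h2, fun j hj hjW => ?_⟩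
  have hlt := (W.equivFin ⟨y j, hjW⟩).2
  have := h3 j hj ⟨W.equivFin ⟨y j, hjW⟩, hlt.trans_le hW⟩
  simp at this

/-- Enough values to avoid for being farther than `N` from all coordinates of an `α`-tuple. -/
noncomputable def avoidCount (α : Type) (N : ℕ) : ℕ := Nat.card α * (2 * N + 1)

theorem Movable.exists_far {α : Type} [Finite α] {J : Set α} {N : ℕ}
    {X : (α → ℤ) → Prop} {x : α → ℤ} (h : Movable J (avoidCount α N) X x) (z : α → ℤ) :
    ∃ y, (∀ i ∉ J, y i = x i) ∧ X y ∧ ∀ j ∈ J, ∀ i, (N : ℤ) < |z i - y j| := by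
  classical
  have := Fintype.ofFinite α
  obtain ⟨y, h1, h2, h3⟩ := h.exists_avoid
    (Finset.univ.biUnion fun i => Finset.Icc (z i - N) (z i + N)) (by
      rw [avoidCount, Nat.card_eq_fintype_card]
      refine Finset.card_biUnion_le_card_mul _ _ _ fun i _ => ?_
      rw [Int.card_Icc]
      omega)
  refine ⟨y, h1, h2, fun j hj i => ?_⟩
  have := h3 j hj
  simp only [Finset.mem_biUnion, Finset.mem_univ, true_and, Finset.mem_Icc, not_exists] at this
  have := this i
  rw [lt_abs]
  omega

theorem movable_of_far {α : Type} [Finite α] {X : (α → ℤ) → Prop} {N : ℕ}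
    (hN : ∀ x y, Sim N x y → X x → X y) {U : Set α}
    (hdep : ∀ x y, (∀ i ∈ U, x i = y i) → X x → X y) {J : Set α} {x : α → ℤ} (hx : X x)
    (hfar : ∀ j ∈ J, ∀ i ∈ U, i ∉ J → (N : ℤ) < |x i - x j|) (L : ℕ) : Movable J L X x := by
  classical
  intro w
  obtain ⟨M, hM⟩ := exists_abs_le x
  obtain ⟨M', hM'⟩ := exists_abs_le w
  let y : α → ℤ := fun i => if i ∈ J then x i + (2 * M + M' + N + 1) else x i
  have hyJ : ∀ i ∈ J, y i = x i + (2 * M + M' + N + 1) := fun i hi => if_pos hi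
  have hyn : ∀ i ∉ J, y i = x i := fun i hi => if_neg hi
  refine ⟨y, fun i hi => hyn i hi, LocalRel.exists_on hN hdep (fun i hi j hj => ?_) hx,
    fun j hj l => ?_⟩
  · have hMi := abs_le.1 (hM i)
    have hMj := abs_le.1 (hM j)
    by_cases hiJ : i ∈ J <;> by_cases hjJ : j ∈ J
    · left; rw [hyJ i hiJ, hyJ j hjJ]; ring
    · right
      refine ⟨abs_sub_comm (x j) (x i) ▸ hfar i hiJ j hj hjJ, ?_⟩
      rw [hyJ i hiJ, hyn j hjJ, lt_abs]; omega
    · right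
      refine ⟨hfar j hjJ i hi hiJ, ?_⟩
      rw [hyJ j hjJ, hyn i hiJ, lt_abs]; omega
    · left; rw [hyn i hiJ, hyn j hjJ]
  · have hMj := abs_le.1 (hM j)
    have hMl := abs_le.1 (hM' l)
    rw [hyJ j hj]
    omega

/-- If no part of the coordinates in `J` can be moved away, all of `J` is near `P`. -/
theorem abs_sub_le_of_not_movable {α : Type} [Finite α] {X : (α → ℤ) → Prop} {N B L : ℕ}
    (hN : ∀ x y, Sim N x y → X x → X y) {P J : Set α}
    (hdep : ∀ x y, (∀ i ∈ P ∪ J, x i = y i) → X x → X y) {x : α → ℤ} (hx : X x)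
    (hdiam : ∀ a ∈ P, ∀ b ∈ P, |x a - x b| ≤ B)
    (hmov : ∀ J' ⊆ J, J'.Nonempty → ¬ Movable J' L X x) {a i : α} (ha : a ∈ P) (hi : i ∈ J) :
    |x a - x i| ≤ (Nat.card α + 1) * (N + B + 1) := by
  classical
  have := Fintype.ofFinite α
  by_contra! hlt
  let lev : α → ℕ := fun j => (x a - x j).natAbs / (N + B + 1)
  have hlev : ∀ j, (N + B + 1) * lev j ≤ (x a - x j).natAbs ∧
      (x a - x j).natAbs < (N + B + 1) * (lev j + 1) := fun j =>
    ⟨Nat.mul_div_le _ _, Nat.lt_mul_div_succ _ (by omega)⟩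
  have hP : ∀ b ∈ P, lev b = 0 := fun b hb =>
    Nat.div_eq_of_lt (by have := abs_le.1 (hdiam a ha b hb); omega)
  obtain ⟨m, hm, hm'⟩ : ∃ m ∈ Finset.range (Nat.card α + 1), m ∉ Finset.univ.image lev := by
    by_contra! h
    have h1 := Finset.card_le_card (fun m hm => h m hm)
    have h2 := Finset.card_image_le (s := (Finset.univ : Finset α)) (f := lev)
    rw [Finset.card_range, Nat.card_eq_fintype_card] at h1
    rw [Finset.card_univ] at h2
    omega
  have hne : ∀ j, lev j ≠ m := by simpa using hm'
  have hm0 : m ≠ 0 := by rw [← hP a ha]; exact (hne a).symm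
  refine hmov {j | j ∈ J ∧ m < lev j} (fun j hj => hj.1) ⟨i, hi, ?_⟩
    (movable_of_far hN hdep hx ?_ L)
  · have h1 := (hlev i).2
    have h2 : (Nat.card α + 1) * (N + B + 1) < (x a - x i).natAbs := by zify; exact hlt
    have h3 : Nat.card α + 1 < lev i + 1 := by
      by_contra! h
      have := Nat.mul_le_mul_left (N + B + 1) h
      rw [mul_comm (N + B + 1) (Nat.card α + 1)] at this
      omega
    rw [Finset.mem_range] at hm
    omega
  · rintro j ⟨hjJ, hj⟩ l hl hlJ
    have hlm : lev l < m := by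
      rcases hl with hl | hl
      · rw [hP l hl]; omega
      · have : ¬ m < lev l := fun h => hlJ ⟨hl, h⟩
        have := hne l
        omega
    have h1 := (hlev j).1
    have h2 := (hlev l).2
    have h3 : (N + B + 1) * (m + 1) ≤ (N + B + 1) * lev j := Nat.mul_le_mul_left _ hj
    have h4 : (N + B + 1) * (lev l + 1) ≤ (N + B + 1) * m := Nat.mul_le_mul_left _ hlm
    rw [mul_add, mul_one] at h3
    rw [lt_abs]
    omega

/-- If every solution of `X` has a coordinate in `J` close to the bounded cluster `P`, then
this happens through a definable finite difference. -/
theorem exists_sub_mem_algDiff {q : ℕ} {Q : (Fin q → ℤ) → Prop} (hQ : LocalRel Q) {α : Type}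
    [Finite α] {P : Set α} {B N : ℕ} (J : Set α) {X : (α → ℤ) → Prop} (hX : DefBy Q X)
    (hPJ : Disjoint P J) (hdep : ∀ x y, (∀ i ∈ P ∪ J, x i = y i) → X x → X y)
    (hdiam : ∀ x, X x → ∀ a ∈ P, ∀ b ∈ P, |x a - x b| ≤ B)
    (hnear : ∀ x, X x → ∃ a ∈ P, ∃ i ∈ J, |x a - x i| ≤ N) {x : α → ℤ} (hx : X x) :
    ∃ a ∈ P, ∃ i ∈ J, x a - x i ∈ algDiff Q ∧ |x a - x i| ≤ N := by
  classical
  induction J using WellFoundedLT.induction generalizing X x with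
  | _ J ih =>
  by_cases hmov : ∃ J' ⊆ J, J'.Nonempty ∧ Movable J' (avoidCount α N) X x
  · obtain ⟨J', hJ', ⟨j, hj⟩, hmov⟩ := hmov
    have hPJ' : ∀ a ∈ P, a ∉ J' := fun a ha h => Set.disjoint_left.1 hPJ ha (hJ' h)
    have key := ih (J \ J') ⟨Set.sdiff_subset, fun h => (h (hJ' hj)).2 hj⟩
      (X := Movable J' (avoidCount α N) X)
      (DefBy.movable (X := fun _ => X) (hX.comp Sum.inr) J' _)
      (hPJ.mono_right Set.sdiff_subset) ?_ ?_ ?_ hmov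
    · obtain ⟨a, ha, i, hi, h⟩ := key
      exact ⟨a, ha, i, hi.1, h⟩
    · intro x y hxy hx w
      obtain ⟨z, h1, h2, h3⟩ := hx w
      refine ⟨fun i => if i ∈ J' then z i else y i, fun i hi => if_neg hi, hdep z _ ?_ h2,
        fun j hj => by simpa only [if_pos hj] using h3 j hj⟩
      intro i hi
      by_cases hiJ : i ∈ J'
      · simp [hiJ]
      · simp only [hiJ, if_false]
        rw [h1 i hiJ]
        exact hxy i (hi.imp id fun h => ⟨h, hiJ⟩)
    · intro x hx a ha b hb
      obtain ⟨z, h1, h2, -⟩ := hx 0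
      rw [← h1 a (hPJ' a ha), ← h1 b (hPJ' b hb)]
      exact hdiam z h2 a ha b hb
    · intro x hx
      obtain ⟨z, h1, h2, h3⟩ := hx.exists_far x
      obtain ⟨a, ha, i, hi, hai⟩ := hnear z h2
      rw [h1 a (hPJ' a ha)] at hai
      by_cases hiJ : i ∈ J'
      · exact absurd hai (not_le.2 (h3 i hiJ a))
      · exact ⟨a, ha, i, ⟨hi, hiJ⟩, by rwa [← h1 i hiJ]⟩
  · push Not at hmov
    obtain ⟨N', hN'⟩ := hX.localRel hQ
    have hY : DefBy Q fun z => X z ∧ ∀ J', J' ⊆ J → J'.Nonempty →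
        ¬ Movable J' (avoidCount α N) X z :=
      hX.and (DefBy.all_index fun J' => (DefBy.const _).imp ((DefBy.const _).imp
        (DefBy.movable (X := fun _ => X) (hX.comp Sum.inr) J' _).neg))
    obtain ⟨a, ha, i, hi, hai⟩ := hnear x hx
    refine ⟨a, ha, i, hi, ?_, hai⟩
    have hfin : {d : ℤ | ∃ z, (X z ∧ ∀ J', J' ⊆ J → J'.Nonempty →
        ¬ Movable J' (avoidCount α N) X z) ∧ d = z a - z i}.Finite := by
      refine (Set.finite_Icc (-((Nat.card α + 1) * (N' + B + 1) : ℤ))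
        ((Nat.card α + 1) * (N' + B + 1))).subset ?_
      rintro d ⟨z, ⟨hz, hz'⟩, rfl⟩
      exact abs_le.1 (abs_sub_le_of_not_movable hN' hdep hz (hdiam z hz) hz' ha hi)
    refine ⟨hfin.toFinset, by simpa using ⟨x, ⟨hx, hmov⟩, rfl⟩, ?_⟩
    obtain ⟨N'', hN''⟩ := hY.localRel hQ
    have : DefBy Q fun v : Fin 2 → ℤ => ∃ z, (X z ∧ ∀ J', J' ⊆ J → J'.Nonempty →
        ¬ Movable J' (avoidCount α N) X z) ∧ v 0 = z a ∧ v 1 = z i :=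
      DefBy.ex ((hY.comp Sum.inr).and ((DefBy.eq _ _).and (DefBy.eq _ _)))
    refine this.congr fun v => ?_
    rw [Set.Finite.mem_toFinset]
    constructor
    · rintro ⟨z, hz, h1, h2⟩
      exact ⟨z, hz, by rw [h1, h2]⟩
    · rintro ⟨z, hz, h⟩
      refine ⟨fun l => z l + (v 0 - z a), hN'' z _ (fun l l' => Or.inl (by ring)) hz, ?_, ?_⟩ <;>
        simp only <;> omega

/-! ### Invariance under moving isolated clusters -/

theorem exists_shift {ι κ : Type} [Finite ι] [Finite κ] (x : ι → ℤ) (z : κ → ℤ) (N : ℕ) :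
    ∃ t : ℤ, ∀ i j, (N : ℤ) < |x i + t - z j| := by
  obtain ⟨M, hM⟩ := exists_abs_le x
  obtain ⟨M', hM'⟩ := exists_abs_le z
  refine ⟨M + M' + N + 1, fun i j => ?_⟩
  have hi := abs_le.1 (hM i)
  have hj := abs_le.1 (hM' j)
  rw [lt_abs]
  omega

/-- The truth of `R` depends on a cluster of coordinates which is far from all others only
up to `rel`-equivalence of its differences, and this equivalence is definable from `R`. -/
structure FarInvariant {k : ℕ} (R : (Fin k → ℤ) → Prop) (n N : ℕ) (rel : ℤ → ℤ → Prop) :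
    Prop where
  equiv : Equivalence rel
  abs_eq {a b : ℤ} : rel a b → |a| = |b|
  definable {d : ℤ} : (n : ℤ) ∣ d →
    DefBy R fun v : Fin 4 → ℤ => |v 0 - v 1| = |d| ∧ rel (v 0 - v 1) (v 2 - v 3)
  dvd_of_mem {d : ℤ} : d ∈ algDiff R → (n : ℤ) ∣ d
  of_sim {x y : Fin k → ℤ} : Sim N x y → R x → R y
  of_far {P : Set (Fin k)} {x y : Fin k → ℤ} : (∀ i ∉ P, y i = x i) →
    (∀ a ∈ P, ∀ b ∈ P, (n : ℤ) ∣ x a - x b) →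
    (∀ a ∈ P, ∀ b ∈ P, rel (x a - x b) (y a - y b)) →
    (∀ a ∈ P, ∀ i ∉ P, (N : ℤ) < |x a - x i|) →
    (∀ a ∈ P, ∀ i ∉ P, (N : ℤ) < |y a - y i|) → R x → R y

namespace FarInvariant

variable {k : ℕ} {R : (Fin k → ℤ) → Prop} {n N : ℕ} {rel : ℤ → ℤ → Prop}

theorem iff_of_far (h : FarInvariant R n N rel) {P : Set (Fin k)} {x y : Fin k → ℤ}
    (hxy : ∀ i ∉ P, y i = x i) (hn : ∀ a ∈ P, ∀ b ∈ P, (n : ℤ) ∣ x a - x b)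
    (hrel : ∀ a ∈ P, ∀ b ∈ P, rel (x a - x b) (y a - y b))
    (hx : ∀ a ∈ P, ∀ i ∉ P, (N : ℤ) < |x a - x i|)
    (hy : ∀ a ∈ P, ∀ i ∉ P, (N : ℤ) < |y a - y i|) : R x ↔ R y :=
  ⟨h.of_far hxy hn hrel hx hy,
    h.of_far (fun i hi => (hxy i hi).symm)
      (fun a ha b hb =>
        (dvd_abs _ _).1 (h.abs_eq (hrel a ha b hb) ▸ (dvd_abs _ _).2 (hn a ha b hb)))
      (fun a ha b hb => h.equiv.symm (hrel a ha b hb)) hy hx⟩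

theorem localRel (h : FarInvariant R n N rel) : LocalRel R := ⟨N, fun _ _ => h.of_sim⟩

theorem iff_of_isolated (h : FarInvariant R n N rel) {P : Set (Fin k)} {x z : Fin k → ℤ}
    (hn : ∀ a ∈ P, ∀ b ∈ P, (n : ℤ) ∣ x a - x b)
    (hiso : ∀ a ∈ P, ∀ i ∉ P, (n : ℤ) ∣ x a - x i → (N : ℤ) < |x a - x i|)
    (hxz : ∀ i ∉ P, z i = x i) (hrel : ∀ a ∈ P, ∀ b ∈ P, rel (x a - x b) (z a - z b))
    (hz : ∀ a ∈ P, ∀ i ∉ P, (N : ℤ) < |z a - z i|) : R x ↔ R z := by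
  classical
  let V : (Fin k → ℤ) → (Fin k → ℤ) → Prop := fun x' y =>
    (∀ a b, a ∈ P ∧ b ∈ P → |x' a - x' b| = |x a - x b| ∧ rel (x' a - x' b) (y a - y b)) ∧
      ¬ (R x' ↔ R y)
  have hV : DefBy R fun u : Fin k ⊕ Fin k → ℤ => V (fun i => u (.inl i)) (fun i => u (.inr i)) := by
    refine DefBy.and (DefBy.all_index fun a => DefBy.all_index fun b => ?_)
      ((DefBy.self.comp Sum.inl).iff (DefBy.self.comp Sum.inr)).neg
    by_cases hab : a ∈ P ∧ b ∈ P
    · exact ((h.definable (hn a hab.1 b hab.2)).comp₄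
        (T := fun p q r s => |p - q| = |x a - x b| ∧ rel (p - q) (r - s))
        (Sum.inl a) (Sum.inl b) (Sum.inr a) (Sum.inr b)).congr fun v => by simp [hab]
    · exact (DefBy.const True).congr fun v => by simp only [hab, false_imp_iff]
  obtain ⟨B, hB⟩ := exists_abs_le fun p : Fin k × Fin k => x p.1 - x p.2
  have hnot : ¬ Movable P (avoidCount (Fin k) N) (V x) x := by
    intro hmov
    obtain ⟨a, ha, i, hi, hai, hai'⟩ := exists_sub_mem_algDiff (B := B) (N := N) h.localRel Pᶜ
      (DefBy.movable hV P (avoidCount (Fin k) N)) disjoint_compl_right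
      (fun x y hxy hx => by
        have : x = y := funext fun i => hxy i (by simp)
        rwa [← this])
      (fun x' hx' a ha b hb => by
        obtain ⟨y, -, hy, -⟩ := hx' 0
        rw [(hy.1 a b ⟨ha, hb⟩).1]
        exact hB (a, b))
      (fun x' hx' => by
        by_contra! hfar
        obtain ⟨y, h1, h2, h3⟩ := hx'.exists_far x'
        refine h2.2 (h.iff_of_far h1 (fun a ha b hb => ?_) (fun a ha b hb => (h2.1 a b ⟨ha, hb⟩).2)
          hfar fun a ha i hi => ?_)
        · rw [← dvd_abs, (h2.1 a b ⟨ha, hb⟩).1, dvd_abs]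
          exact hn a ha b hb
        · rw [h1 i hi, abs_sub_comm]
          exact h3 a ha i)
      hmov
    exact absurd hai' (not_le.2 (hiso a ha i hi (h.dvd_of_mem hai)))
  unfold Movable at hnot
  push Not at hnot
  obtain ⟨w, hw⟩ := hnot
  obtain ⟨t, ht⟩ := exists_shift x (Sum.elim x w) N
  let y : Fin k → ℤ := fun i => if i ∈ P then x i + t else x i
  have hyP : ∀ i ∈ P, y i = x i + t := fun i hi => if_pos hi
  have hyn : ∀ i ∉ P, y i = x i := fun i hi => if_neg hi
  have hyd : ∀ a ∈ P, ∀ b ∈ P, y a - y b = x a - x b := fun a ha b hb => by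
    rw [hyP a ha, hyP b hb]; ring
  have hxy : R x ↔ R y := by
    by_contra hne
    obtain ⟨j, hj, l, hl⟩ := hw y hyn ⟨fun a b hab =>
      ⟨rfl, by rw [hyd a hab.1 b hab.2]; exact h.equiv.refl _⟩, hne⟩
    have := ht j (.inr l)
    rw [← hyP j hj, Sum.elim_inr, hl, sub_self, abs_zero] at this
    omega
  refine hxy.trans (h.iff_of_far (P := P) (fun i hi => (hxz i hi).trans (hyn i hi).symm)
    (fun a ha b hb => hyd a ha b hb ▸ hn a ha b hb)
    (fun a ha b hb => hyd a ha b hb ▸ hrel a ha b hb) (fun a ha i hi => ?_) hz)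
  rw [hyP a ha, hyn i hi]
  exact ht a (.inl i)

end FarInvariant

/-- Two indices are adjacent if the corresponding coordinates differ by a small multiple
of `n`. -/
def nearGraph (n N : ℕ) {k : ℕ} (x : Fin k → ℤ) : SimpleGraph (Fin k) where
  Adj i j := i ≠ j ∧ (n : ℤ) ∣ x i - x j ∧ |x i - x j| ≤ N
  symm := ⟨fun i j h => ⟨h.1.symm, dvd_sub_comm.1 h.2.1, abs_sub_comm (x i) (x j) ▸ h.2.2⟩⟩
  loopless := ⟨fun _ h => h.1 rfl⟩

theorem nearGraph_reachable {n N k : ℕ} {x : Fin k → ℤ} {i j : Fin k}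
    (h : (nearGraph n N x).Reachable i j) : (n : ℤ) ∣ x i - x j ∧ |x i - x j| ≤ k * N := by
  obtain ⟨p, hp⟩ := h.exists_isPath
  have key : ∀ {i j} (p : (nearGraph n N x).Walk i j),
      (n : ℤ) ∣ x i - x j ∧ |x i - x j| ≤ p.length * N := by
    intro i j p
    induction p with
    | nil => simp
    | @cons i l j hil p ih =>
      refine ⟨by simpa using hil.2.1.add ih.1, ?_⟩
      have h1 := abs_add_le (x i - x l) (x l - x j)
      rw [sub_add_sub_cancel] at h1
      have h2 := hil.2.2
      have h3 := ih.2
      rw [SimpleGraph.Walk.length_cons]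
      push_cast
      linarith
  refine ⟨(key p).1, (key p).2.trans ?_⟩
  have := hp.length_lt
  rw [Fintype.card_fin] at this
  gcongr

namespace FarInvariant

variable {k : ℕ} {R : (Fin k → ℤ) → Prop} {n N : ℕ} {rel : ℤ → ℤ → Prop}

theorem exists_spread_on (h : FarInvariant R n N rel) {x y : Fin k → ℤ}
    (hrel : ∀ i j, (nearGraph n N x).Reachable i j → rel (x i - x j) (y i - y j))
    (A : Finset (Fin k)) : ∃ x', (R x ↔ R x') ∧
      (∀ i, (∀ a ∈ A, ¬ (nearGraph n N x).Reachable a i) → x' i = x i) ∧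
      (∀ a ∈ A, ∀ i j, (nearGraph n N x).Reachable a i → (nearGraph n N x).Reachable a j →
        x' i - x' j = y i - y j) ∧
      ∀ a ∈ A, ∀ i j, (nearGraph n N x).Reachable a i → ¬ (nearGraph n N x).Reachable a j →
        (N : ℤ) < |x' i - x' j| := by
  classical
  induction A using Finset.induction_on with
  | empty => exact ⟨x, by simp⟩
  | insert a A _ ih =>
    obtain ⟨x', hR, h1, h2, h3⟩ := ih
    by_cases haA : ∃ b ∈ A, (nearGraph n N x).Reachable b a
    · obtain ⟨b, hb, hba⟩ := haA
      have hab : ∀ i, (nearGraph n N x).Reachable a i ↔ (nearGraph n N x).Reachable b i :=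
        fun i => ⟨hba.trans, hba.symm.trans⟩
      refine ⟨x', hR, fun i hi => h1 i fun c hc => hi c (Finset.mem_insert_of_mem hc), ?_, ?_⟩
      · rw [Finset.forall_mem_insert]
        simp only [hab]
        exact ⟨h2 b hb, h2⟩
      · rw [Finset.forall_mem_insert]
        simp only [hab]
        exact ⟨h3 b hb, h3⟩
    · push Not at haA
      let P : Set (Fin k) := {i | (nearGraph n N x).Reachable a i}
      have hPA : ∀ b ∈ A, ∀ i ∈ P, ¬ (nearGraph n N x).Reachable b i := fun b hb i hi hbi =>
        haA b hb (hbi.trans hi.symm)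
      have hxP : ∀ i ∈ P, x' i = x i := fun i hi => h1 i fun b hb => hPA b hb i hi
      obtain ⟨t, ht⟩ := exists_shift y x' N
      let z : Fin k → ℤ := fun i => if i ∈ P then y i + t else x' i
      have hzP : ∀ i ∈ P, z i = y i + t := fun i hi => if_pos hi
      have hzn : ∀ i ∉ P, z i = x' i := fun i hi => if_neg hi
      have hzd : ∀ i ∈ P, ∀ j ∈ P, z i - z j = y i - y j := fun i hi j hj => by
        rw [hzP i hi, hzP j hj]; ring
      have hzfar : ∀ i ∈ P, ∀ j ∉ P, (N : ℤ) < |z i - z j| := fun i hi j hj => by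
        rw [hzP i hi, hzn j hj]; exact ht i j
      have hxz : R x' ↔ R z := by
        refine h.iff_of_isolated (P := P) (fun i hi j hj => ?_) (fun i hi j hj hij => ?_) hzn
          (fun i hi j hj => ?_) hzfar
        · rw [hxP i hi, hxP j hj]
          exact (nearGraph_reachable (hi.symm.trans hj)).1
        · by_cases hjA : ∃ b ∈ A, (nearGraph n N x).Reachable b j
          · obtain ⟨b, hb, hbj⟩ := hjA
            rw [abs_sub_comm]
            exact h3 b hb j i hbj (hPA b hb i hi)
          · push Not at hjA
            rw [hxP i hi, h1 j hjA] at hij ⊢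
            by_contra! hle
            have : (nearGraph n N x).Adj i j := ⟨fun e => hj (e ▸ hi), hij, hle⟩
            exact hj (hi.trans this.reachable)
        · rw [hzd i hi j hj, hxP i hi, hxP j hj]
          exact hrel i j (hi.symm.trans hj)
      refine ⟨z, hR.trans hxz, fun i hi => ?_, ?_, ?_⟩
      · rw [Finset.forall_mem_insert] at hi
        rw [hzn i hi.1, h1 i hi.2]
      · rw [Finset.forall_mem_insert]
        refine ⟨fun i j hi hj => hzd i hi j hj, fun b hb i j hi hj => ?_⟩
        rw [hzn i fun h => hPA b hb i h hi, hzn j fun h => hPA b hb j h hj]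
        exact h2 b hb i j hi hj
      · rw [Finset.forall_mem_insert]
        refine ⟨fun i j hi hj => hzfar i hi j hj, fun b hb i j hi hj => ?_⟩
        have hiP : i ∉ P := fun h => hPA b hb i h hi
        by_cases hjP : j ∈ P
        · rw [abs_sub_comm]
          exact hzfar j hjP i hiP
        · rw [hzn i hiP, hzn j hjP]
          exact h3 b hb i j hi hj

theorem exists_spread (h : FarInvariant R n N rel) {x y : Fin k → ℤ}
    (hrel : ∀ i j, (nearGraph n N x).Reachable i j → rel (x i - x j) (y i - y j)) :
    ∃ x', (R x ↔ R x') ∧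
      (∀ i j, (nearGraph n N x).Reachable i j → x' i - x' j = y i - y j) ∧
      ∀ i j, ¬ (nearGraph n N x).Reachable i j → (N : ℤ) < |x' i - x' j| := by
  obtain ⟨x', hR, -, h2, h3⟩ := h.exists_spread_on hrel Finset.univ
  exact ⟨x', hR, fun i j => h2 i (Finset.mem_univ i) i j (.refl i),
    fun i j => h3 i (Finset.mem_univ i) i j (.refl i)⟩

/-- `R` only depends on the small differences divisible by `n`, up to `rel`. -/
theorem iff_of_rel (h : FarInvariant R n N rel) {x y : Fin k → ℤ}
    (hxy : ∀ i j, (n : ℤ) ∣ x i - x j → |x i - x j| ≤ k * N → rel (x i - x j) (y i - y j))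
    (hyx : ∀ i j, (n : ℤ) ∣ y i - y j → |y i - y j| ≤ k * N → rel (y i - y j) (x i - x j)) :
    R x ↔ R y := by
  have mono : ∀ {x y : Fin k → ℤ},
      (∀ i j, (n : ℤ) ∣ x i - x j → |x i - x j| ≤ k * N → rel (x i - x j) (y i - y j)) →
      nearGraph n N x ≤ nearGraph n N y := fun {x y} hxy i j hij => by
    have hk : (1 : ℤ) ≤ k := by have := i.pos; omega
    have := h.abs_eq (hxy i j hij.2.1 (hij.2.2.trans (le_mul_of_one_le_left (by simp) hk)))
    exact ⟨hij.1, by rw [← dvd_abs, ← this, dvd_abs]; exact hij.2.1, this ▸ hij.2.2⟩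
  have hG := le_antisymm (mono hxy) (mono hyx)
  obtain ⟨x', hx, h1, h2⟩ := h.exists_spread fun i j hij =>
    hxy i j (nearGraph_reachable hij).1 (nearGraph_reachable hij).2
  obtain ⟨y', hy, h3, h4⟩ := h.exists_spread (x := y) (y := y) fun i j _ => h.equiv.refl _
  have hsim : Sim N x' y' := fun i j => by
    by_cases hij : (nearGraph n N x).Reachable i j
    · exact .inl ((h1 i j hij).trans (h3 i j (hG ▸ hij)).symm)
    · exact .inr ⟨h2 i j hij, h4 i j (hG ▸ hij)⟩
  exact hx.trans (Iff.trans ⟨h.of_sim hsim, h.of_sim hsim.symm⟩ hy.symm)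

end FarInvariant

/-! ### Orientations -/

/-- Multiples of `n` of absolute value at most `M`. -/
def smallMultiples (n M : ℕ) : Set ℤ := {d | (n : ℤ) ∣ d ∧ |d| ≤ M}

instance (n M : ℕ) : Finite (smallMultiples n M) :=
  ((Set.finite_Icc (-(M : ℤ)) M).subset fun _ h => abs_le.1 h.2).to_subtype

theorem neg_mem_smallMultiples {n M : ℕ} {d : ℤ} (h : d ∈ smallMultiples n M) :
    -d ∈ smallMultiples n M :=
  ⟨(dvd_neg).2 h.1, (abs_neg d).symm ▸ h.2⟩

theorem FarInvariant.iff_of_small {k : ℕ} {R : (Fin k → ℤ) → Prop} {n N : ℕ}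
    {rel : ℤ → ℤ → Prop} (h : FarInvariant R n N rel) {x y : Fin k → ℤ}
    (hxy : ∀ i j, x i - x j ∈ smallMultiples n (k * N) → rel (x i - x j) (y i - y j))
    (hyx : ∀ i j, y i - y j ∈ smallMultiples n (k * N) → rel (y i - y j) (x i - x j)) :
    R x ↔ R y :=
  h.iff_of_rel (fun i j h1 h2 => hxy i j ⟨h1, by exact_mod_cast h2⟩)
    fun i j h1 h2 => hyx i j ⟨h1, by exact_mod_cast h2⟩

/-- The differences `a` and `b` equal `d` and `e` up to a common sign. -/
def Cooriented (d e a b : ℤ) : Prop := (a = d ∧ b = e) ∨ (a = -d ∧ b = -e)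

theorem mem_algDiff_of_dvd {q : ℕ} {Q : (Fin q → ℤ) → Prop} {c d : ℤ} (hc : c ∈ algDiff Q)
    (h : c ∣ d) : d ∈ algDiff Q := by
  obtain ⟨m, rfl⟩ := h
  rw [mul_comm, ← smul_eq_mul]
  exact zsmul_mem hc m

theorem DefBy.cooriented {q : ℕ} {Q : (Fin q → ℤ) → Prop} {c : ℤ} (hc : c ≠ 0)
    (hB : DefBy Q fun v : Fin 4 → ℤ => Cooriented c c (v 0 - v 1) (v 2 - v 3))
    {d e : ℤ} (hcQ : c ∈ algDiff Q) (hd : d ∈ algDiff Q) (he : e ∈ algDiff Q) :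
    DefBy Q fun v : Fin 4 → ℤ => Cooriented d e (v 0 - v 1) (v 2 - v 3) := by
  have half : ∀ {d}, d ∈ algDiff Q →
      DefBy Q fun v : Fin 4 → ℤ => Cooriented d c (v 0 - v 1) (v 2 - v 3) := by
    intro d hd
    have : DefBy Q fun v : Fin 4 → ℤ => |v 0 - v 1| = |d| ∧
        ∃ w : ℤ, |v 1 - w| = |c - d| ∧ Cooriented c c (v 0 - w) (v 2 - v 3) := by
      refine ((DefBy.abs_sub_of_mem_algDiff hd).comp₂ (T := fun a b => |a - b| = |d|) 0 1).and ?_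
      refine DefBy.ex₁ (DefBy.and ?_ ?_)
      · exact (DefBy.abs_sub_of_mem_algDiff (sub_mem hcQ hd)).comp₂
          (T := fun a b => |a - b| = |c - d|)
          (Sum.inl 1) (Sum.inr ())
      · exact hB.comp₄ (T := fun a b a' b' => Cooriented c c (a - b) (a' - b'))
          (Sum.inl 0) (Sum.inr ()) (Sum.inl 2) (Sum.inl 3)
    refine this.congr fun v => ?_
    unfold Cooriented
    constructor
    · rintro ⟨h1, w, h2, h3⟩
      rw [abs_eq_abs] at h1 h2
      omega
    · rintro (⟨h1, h2⟩ | ⟨h1, h2⟩)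
      · refine ⟨by rw [h1], v 0 - c, ?_, .inl ⟨by ring, h2⟩⟩
        congr 1
        linarith
      · refine ⟨by rw [h1, abs_neg], v 0 + c, ?_, .inr ⟨by ring, h2⟩⟩
        rw [abs_eq_abs]
        omega
  have : DefBy Q fun v : Fin 4 → ℤ => ∃ w : Fin 2 → ℤ,
      Cooriented d c (v 0 - v 1) (w 0 - w 1) ∧ Cooriented e c (v 2 - v 3) (w 0 - w 1) := by
    refine DefBy.ex (DefBy.and ?_ ?_)
    · exact (half hd).comp₄ (T := fun a b a' b' => Cooriented d c (a - b) (a' - b'))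
        (Sum.inl 0) (Sum.inl 1) (Sum.inr 0) (Sum.inr 1)
    · exact (half he).comp₄ (T := fun a b a' b' => Cooriented e c (a - b) (a' - b'))
        (Sum.inl 2) (Sum.inl 3) (Sum.inr 0) (Sum.inr 1)
  refine this.congr fun v => ?_
  unfold Cooriented
  constructor
  · rintro ⟨w, h1, h2⟩
    omega
  · rintro (h | h)
    · exact ⟨![c, 0], .inl ⟨h.1, by simp⟩, .inl ⟨h.2, by simp⟩⟩
    · exact ⟨![-c, 0], .inr ⟨h.1, by simp⟩, .inr ⟨h.2, by simp⟩⟩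

theorem DefBy.cooriented_zero {q : ℕ} {Q : (Fin q → ℤ) → Prop} :
    DefBy Q fun v : Fin 4 → ℤ => Cooriented 0 0 (v 0 - v 1) (v 2 - v 3) :=
  ((DefBy.eq 0 1).and (DefBy.eq 2 3)).congr fun v => by
    unfold Cooriented
    omega

theorem DefBy.sub_eq_of_dvd {q : ℕ} {Q : (Fin q → ℤ) → Prop} {c d : ℤ}
    (hc : DefBy Q fun v : Fin 2 → ℤ => v 0 - v 1 = c) (h : c ∣ d) :
    DefBy Q fun v : Fin 2 → ℤ => v 0 - v 1 = d := by
  have add : ∀ {a b : ℤ}, DefBy Q (fun v : Fin 2 → ℤ => v 0 - v 1 = a) →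
      DefBy Q (fun v : Fin 2 → ℤ => v 0 - v 1 = b) →
      DefBy Q fun v : Fin 2 → ℤ => v 0 - v 1 = a + b := by
    intro a b ha hb
    have : DefBy Q fun v : Fin 2 → ℤ => ∃ w : ℤ, v 0 - w = a ∧ w - v 1 = b :=
      DefBy.ex₁ ((ha.comp₂ (T := fun p q => p - q = a) (Sum.inl 0) (Sum.inr ())).and
        (hb.comp₂ (T := fun p q => p - q = b) (Sum.inr ()) (Sum.inl 1)))
    refine this.congr fun v => ⟨?_, fun h => ⟨v 0 - a, ?_⟩⟩
    · rintro ⟨w, h1, h2⟩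
      omega
    · omega
  have neg : DefBy Q fun v : Fin 2 → ℤ => v 0 - v 1 = -c :=
    (hc.comp₂ (T := fun p q => p - q = c) 1 0).congr fun v => by omega
  obtain ⟨m, rfl⟩ := h
  induction m using Int.induction_on with
  | zero => exact (DefBy.eq 0 1).congr fun v => by rw [mul_zero, sub_eq_zero]
  | succ m ih => rw [mul_add, mul_one]; exact add ih hc
  | pred m ih => rw [mul_sub, mul_one]; exact add ih neg

theorem sub_eq_or_eq_neg_of_abs_eq {α : Type} {P : Set α} {x y : α → ℤ}
    (h : ∀ a ∈ P, ∀ b ∈ P, |x a - x b| = |y a - y b|) :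
    (∀ a ∈ P, ∀ b ∈ P, x a - x b = y a - y b) ∨ ∀ a ∈ P, ∀ b ∈ P, x a - x b = -(y a - y b) := by
  by_contra! hne
  obtain ⟨⟨a, ha, b, hb, hab⟩, c, hc, d, hd, hcd⟩ := hne
  have h1 := abs_eq_abs.1 (h a ha b hb)
  have h2 := abs_eq_abs.1 (h a ha c hc)
  have h3 := abs_eq_abs.1 (h a ha d hd)
  have h4 := abs_eq_abs.1 (h b hb c hc)
  have h5 := abs_eq_abs.1 (h b hb d hd)
  have h6 := abs_eq_abs.1 (h c hc d hd)
  omega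

theorem Sim.of_cluster {α : Type} {N : ℕ} {P : Set α} {x y : α → ℤ}
    (hP : ∀ a ∈ P, ∀ b ∈ P, x a - x b = y a - y b)
    (hP' : ∀ i ∉ P, ∀ j ∉ P, x i - x j = y i - y j)
    (hx : ∀ a ∈ P, ∀ i ∉ P, (N : ℤ) < |x a - x i|)
    (hy : ∀ a ∈ P, ∀ i ∉ P, (N : ℤ) < |y a - y i|) : Sim N x y := by
  intro i j
  by_cases hi : i ∈ P <;> by_cases hj : j ∈ P
  · exact .inl (hP i hi j hj)
  · exact .inr ⟨hx i hi j hj, hy i hi j hj⟩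
  · rw [abs_sub_comm, abs_sub_comm (y i)]
    exact .inr ⟨hx j hj i hi, hy j hj i hi⟩
  · exact .inl (hP' i hi j hj)

/-- If `R` distinguishes a far cluster from its mirror image, it defines a relation which
compares orientations. -/
theorem exists_cooriented {k : ℕ} {R : (Fin k → ℤ) → Prop} {N : ℕ}
    (hN : ∀ x y, Sim N x y → R x → R y) {P : Set (Fin k)} {x y : Fin k → ℤ}
    (hxy : ∀ i ∉ P, y i = x i) (hP : ∀ a ∈ P, ∀ b ∈ P, x a - x b ∈ algDiff R)
    (hrel : ∀ a ∈ P, ∀ b ∈ P, |x a - x b| = |y a - y b|)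
    (hx : ∀ a ∈ P, ∀ i ∉ P, (N : ℤ) < |x a - x i|)
    (hy : ∀ a ∈ P, ∀ i ∉ P, (N : ℤ) < |y a - y i|) (hRx : R x) (hRy : ¬ R y) :
    ∃ c ≠ 0, c ∈ algDiff R ∧
      DefBy R fun v : Fin 4 → ℤ => Cooriented c c (v 0 - v 1) (v 2 - v 3) := by
  classical
  have hiff : ∀ {x y}, Sim N x y → (R x ↔ R y) := fun h => ⟨hN _ _ h, hN _ _ h.symm⟩
  have hne : ¬ ∀ a ∈ P, ∀ b ∈ P, x a - x b = y a - y b := fun heq =>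
    hRy (hN x y (Sim.of_cluster heq (fun i hi j hj => by rw [hxy i hi, hxy j hj]) hx hy) hRx)
  have hflip := (sub_eq_or_eq_neg_of_abs_eq hrel).resolve_left hne
  push Not at hne
  obtain ⟨a₀, ha₀, b₀, hb₀, hab⟩ := hne
  have hab' := hflip a₀ ha₀ b₀ hb₀
  refine ⟨x a₀ - x b₀, fun h => hab (by omega), hP a₀ ha₀ b₀ hb₀, ?_⟩
  let mix : (Fin k ⊕ Fin k → ℤ) → Fin k → ℤ := fun q i => q (if i ∈ P then .inr i else .inl i)
  have hmixP : ∀ q, ∀ i ∈ P, mix q i = q (.inr i) := fun q i hi => by simp [mix, hi]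
  have hmixn : ∀ q, ∀ i ∉ P, mix q i = q (.inl i) := fun q i hi => by simp [mix, hi]
  let V : (Fin k ⊕ Fin k → ℤ) → Prop := fun q => ¬ (R (fun i => q (.inl i)) ↔ R (mix q))
  have hV : DefBy R V := ((DefBy.self.comp Sum.inl).iff (DefBy.self.comp _)).neg
  let J : Set (Fin k ⊕ Fin k) := {i | ∃ j ∉ P, i = .inl j}
  have hinl : ∀ i ∈ P, .inl i ∉ J := fun i hi ⟨j, hj, hij⟩ => hj (Sum.inl_injective hij ▸ hi)
  have hinr : ∀ i, .inr i ∉ J := fun i ⟨j, hj, hij⟩ => nomatch hij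
  let L := avoidCount (Fin k ⊕ Fin k) N
  have hsame : ∀ q : Fin k ⊕ Fin k → ℤ,
      (∀ a ∈ P, ∀ b ∈ P, q (.inl a) - q (.inl b) = q (.inr a) - q (.inr b)) →
      ¬ Movable J L V q := by
    intro q hq hmov
    obtain ⟨z, h1, h2, h3⟩ := hmov.exists_far q
    refine h2 (hiff (Sim.of_cluster (P := P) (fun a ha b hb => ?_) (fun i hi j hj => ?_)
      (fun a ha i hi => ?_) fun a ha i hi => ?_))
    · rw [hmixP z a ha, hmixP z b hb, h1 _ (hinl a ha), h1 _ (hinl b hb), h1 _ (hinr a),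
        h1 _ (hinr b)]
      exact hq a ha b hb
    · rw [hmixn z i hi, hmixn z j hj]
    · rw [h1 _ (hinl a ha)]
      exact h3 _ ⟨i, hi, rfl⟩ _
    · rw [hmixP z a ha, hmixn z i hi, h1 _ (hinr a)]
      exact h3 _ ⟨i, hi, rfl⟩ _
  have hopp : ∀ q : Fin k ⊕ Fin k → ℤ,
      (∀ a ∈ P, ∀ b ∈ P, |q (.inl a) - q (.inl b)| = |x a - x b|) →
      (∀ a ∈ P, ∀ b ∈ P, q (.inl a) - q (.inl b) = -(q (.inr a) - q (.inr b))) →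
      Movable J L V q := by
    intro q hq hq' w
    obtain ⟨t, ht⟩ := exists_shift x (Sum.elim q w) N
    let z : Fin k ⊕ Fin k → ℤ := fun i => if i ∈ J then x (i.elim id id) + t else q i
    have hzJ : ∀ i ∉ P, z (.inl i) = x i + t := fun i hi => if_pos ⟨i, hi, rfl⟩
    have hzn : ∀ i ∉ J, z i = q i := fun i hi => if_neg hi
    have cluster : ∀ {g u : Fin k → ℤ} {s : Fin k → Fin k ⊕ Fin k}, (∀ a ∈ P, g a = q (s a)) →
        (∀ i ∉ P, g i = x i + t) → (∀ i ∉ P, u i = x i) →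
        (∀ a ∈ P, ∀ i ∉ P, (N : ℤ) < |u a - u i|) →
        (∀ a ∈ P, ∀ b ∈ P, q (s a) - q (s b) = u a - u b) → (R g ↔ R u) := by
      intro g u s hg hg' hu hu' hgu
      refine hiff (Sim.of_cluster (P := P) (fun a ha b hb => ?_) (fun i hi j hj => ?_)
        (fun a ha i hi => ?_) hu')
      · rw [hg a ha, hg b hb, hgu a ha b hb]
      · rw [hg' i hi, hg' j hj, hu i hi, hu j hj]
        ring
      · rw [hg a ha, hg' i hi, abs_sub_comm]
        exact ht i (.inl (s a))
    refine ⟨z, hzn, ?_, ?_⟩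
    · have e1 : ∀ a ∈ P, z (.inl a) = q (.inl a) := fun a ha => hzn _ (hinl a ha)
      have e2 : ∀ a ∈ P, mix z a = q (.inr a) := fun a ha => (hmixP z a ha).trans (hzn _ (hinr a))
      have e3 : ∀ i ∉ P, mix z i = x i + t := fun i hi => (hmixn z i hi).trans (hzJ i hi)
      rcases sub_eq_or_eq_neg_of_abs_eq hq with h | h
      · have h1 := cluster e1 hzJ (fun _ _ => rfl) hx h
        have h2 := cluster e2 e3 hxy hy fun a ha b hb => by
          have := h a ha b hb
          have := hq' a ha b hb
          have := hflip a ha b hb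
          omega
        exact fun hzz => hRy (h2.1 (hzz.1 (h1.2 hRx)))
      · have h1 := cluster e1 hzJ hxy hy fun a ha b hb => by
          have := h a ha b hb
          have := hflip a ha b hb
          omega
        have h2 := cluster e2 e3 (fun _ _ => rfl) hx fun a ha b hb => by
          have := h a ha b hb
          have := hq' a ha b hb
          omega
        exact fun hzz => hRy (h1.1 (hzz.2 (h2.2 hRx)))
    · rintro _ ⟨j, hj, rfl⟩ l hl
      have := ht j (.inr l)
      rw [← hzJ j hj, Sum.elim_inr, hl, sub_self, abs_zero] at this
      omega
  have hdef : DefBy R fun v : Fin 4 → ℤ => ∃ q : Fin k ⊕ Fin k → ℤ,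
      (∀ a b, a ∈ P ∧ b ∈ P → |q (.inl a) - q (.inl b)| = |x a - x b| ∧
        |q (.inr a) - q (.inr b)| = |x a - x b|) ∧
      (v 0 = q (.inl a₀) ∧ v 1 = q (.inl b₀) ∧ v 2 = q (.inr a₀) ∧ v 3 = q (.inr b₀)) ∧
      ¬ Movable J L V q := by
    refine DefBy.ex (DefBy.and (DefBy.all_index fun a => DefBy.all_index fun b => ?_)
      (((DefBy.eq _ _).and ((DefBy.eq _ _).and ((DefBy.eq _ _).and (DefBy.eq _ _)))).and ?_))
    · by_cases hab : a ∈ P ∧ b ∈ P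
      · have := DefBy.abs_sub_of_mem_algDiff (hP a hab.1 b hab.2)
        exact ((this.comp₂ (T := fun p q => |p - q| = |x a - x b|)
          (Sum.inr (Sum.inl a)) (Sum.inr (Sum.inl b))).and
          (this.comp₂ (T := fun p q => |p - q| = |x a - x b|)
          (Sum.inr (Sum.inr a)) (Sum.inr (Sum.inr b)))).congr fun v => by simp [hab]
      · exact (DefBy.const True).congr fun v => by simp only [hab, false_imp_iff]
    · exact ((DefBy.movable (X := fun _ => V) (hV.comp Sum.inr) J L).comp Sum.inr).neg
  refine hdef.congr fun v => ⟨?_, fun hv => ?_⟩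
  · rintro ⟨q, h1, ⟨e0, e1, e2, e3⟩, h3⟩
    have h4 : ∀ a ∈ P, ∀ b ∈ P, |q (.inl a) - q (.inl b)| = |x a - x b| :=
      fun a ha b hb => (h1 a b ⟨ha, hb⟩).1
    have h5 := (sub_eq_or_eq_neg_of_abs_eq (P := P) (x := fun a => q (.inl a))
      (y := fun a => q (.inr a)) fun a ha b hb =>
        (h4 a ha b hb).trans (h1 a b ⟨ha, hb⟩).2.symm).resolve_right fun h => h3 (hopp q h4 h)
    have h6 := h5 a₀ ha₀ b₀ hb₀
    have h7 := abs_eq_abs.1 (h4 a₀ ha₀ b₀ hb₀)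
    rw [e0, e1, e2, e3]
    unfold Cooriented
    omega
  · obtain ⟨s, hs, h1, h2⟩ : ∃ s : ℤ, |s| = 1 ∧ v 0 - v 1 = s * (x a₀ - x b₀) ∧
        v 2 - v 3 = s * (x a₀ - x b₀) := by
      rcases hv with hv | hv
      · exact ⟨1, by simp, by simpa using hv⟩
      · exact ⟨-1, by simp, by simpa using hv⟩
    have habs : ∀ u a b, |u + s * (x a - x a₀) - (u + s * (x b - x a₀))| = |x a - x b| := by
      intro u a b
      rw [show u + s * (x a - x a₀) - (u + s * (x b - x a₀)) = s * (x a - x b) by ring, abs_mul, hs,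
        one_mul]
    refine ⟨Sum.elim (fun i => v 0 + s * (x i - x a₀)) (fun i => v 2 + s * (x i - x a₀)),
      fun a b _ => ⟨habs _ a b, habs _ a b⟩, ⟨?_, ?_, ?_, ?_⟩, hsame _ fun a _ b _ => ?_⟩ <;>
      simp only [Sum.elim_inl, Sum.elim_inr] <;> linarith

/-! ### The three cases -/

section Cases

variable {k : ℕ} {R : (Fin k → ℤ) → Prop} {n N : ℕ}

theorem FarInvariant.defBy_CZ (h : FarInvariant R n N fun a b => |a| = |b|) : DefBy (CZ n) R := by
  have hn : (n : ℤ) ∈ algDiff (CZ n) :=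
    mem_algDiff_of_abs_sub (DefBy.self.congr fun v => by simp [CZ])
  refine DefBy.of_finite (ι := smallMultiples n (k * N) × Fin k × Fin k)
    (e := fun i v => |v i.2.1 - v i.2.2| = |i.1.1|) (fun i =>
      (DefBy.abs_sub_of_mem_algDiff (mem_algDiff_of_dvd hn i.1.2.1)).comp₂
        (T := fun p q => |p - q| = |i.1.1|) i.2.1 i.2.2) fun x y hxy => ?_
  exact (h.iff_of_small (fun i j hij => ((hxy (⟨_, hij⟩, i, j)).1 rfl).symm)
    fun i j hij => ((hxy (⟨_, hij⟩, i, j)).2 rfl).symm).1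

theorem FarInvariant.defBy_AZ (h : FarInvariant R n N Eq) : DefBy (AZ n) R := by
  refine DefBy.of_finite (ι := smallMultiples n (k * N) × Fin k × Fin k)
    (e := fun i v => v i.2.1 - v i.2.2 = i.1.1) (fun i =>
      (DefBy.sub_eq_of_dvd (c := n) DefBy.self i.1.2.1).comp₂
        (T := fun p q => p - q = i.1.1) i.2.1 i.2.2) fun x y hxy => ?_
  exact (h.iff_of_small (fun i j hij => ((hxy (⟨_, hij⟩, i, j)).1 rfl).symm)
    fun i j hij => ((hxy (⟨_, hij⟩, i, j)).2 rfl).symm).1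

theorem exists_sign_of_cooriented {S : Set ℤ} (hS : ∀ d ∈ S, -d ∈ S) {α : Type} {x y : α → ℤ}
    (hxy : ∀ d ∈ S, ∀ e ∈ S, ∀ i j l m, Cooriented d e (x i - x j) (x l - x m) ↔
      Cooriented d e (y i - y j) (y l - y m)) :
    (∀ l m, (x l - x m ∈ S → y l - y m = x l - x m) ∧ (y l - y m ∈ S → x l - x m = y l - y m)) ∨
    ∀ l m, (x l - x m ∈ S → y l - y m = -(x l - x m)) ∧
      (y l - y m ∈ S → x l - x m = -(y l - y m)) := by
  by_cases hne : ∃ i j, x i - x j ∈ S ∧ x i - x j ≠ 0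
  · obtain ⟨i, j, hij, h0⟩ := hne
    have h1 := (hxy _ hij _ hij i j i j).1 (.inl ⟨rfl, rfl⟩)
    have h2 : ∀ l m, x l - x m ∈ S → Cooriented (x i - x j) (x l - x m) (y i - y j) (y l - y m) :=
      fun l m hlm => (hxy _ hij _ hlm i j l m).1 (.inl ⟨rfl, rfl⟩)
    have h3 : ∀ l m, y l - y m ∈ S → Cooriented (y i - y j) (y l - y m) (x i - x j) (x l - x m) :=
      fun l m hlm => (hxy _ (by rcases h1 with h | h <;> rw [h.1]; exacts [hij, hS _ hij])
        _ hlm i j l m).2 (.inl ⟨rfl, rfl⟩)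
    unfold Cooriented at h1 h2 h3
    rcases h1 with h1 | h1
    · refine .inl fun l m => ⟨fun h => ?_, fun h => ?_⟩
      · have := h2 l m h
        omega
      · have := h3 l m h
        omega
    · refine .inr fun l m => ⟨fun h => ?_, fun h => ?_⟩
      · have := h2 l m h
        omega
      · have := h3 l m h
        omega
  · push Not at hne
    refine .inl fun l m => ⟨fun h => ?_, fun h => ?_⟩
    · have := (hxy _ h _ h l m l m).1 (.inl ⟨rfl, rfl⟩)
      have h0 := hne l m h
      unfold Cooriented at this
      omega
    · have := (hxy _ h _ h l m l m).2 (.inl ⟨rfl, rfl⟩)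
      have h0 := hne l m (by rcases this with h' | h' <;> rw [h'.1]; exacts [h, hS _ h])
      unfold Cooriented at this
      omega

theorem defBy_BZ_cooriented {d e : ℤ} (hd : (n : ℤ) ∣ d) (he : (n : ℤ) ∣ e) :
    DefBy (BZ n) fun v : Fin 4 → ℤ => Cooriented d e (v 0 - v 1) (v 2 - v 3) := by
  rcases eq_or_ne (n : ℤ) 0 with h0 | h0
  · rw [h0, zero_dvd_iff] at hd he
    rw [hd, he]
    exact DefBy.cooriented_zero
  · have hn : (n : ℤ) ∈ algDiff (BZ n) := mem_algDiff_of_abs_sub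
      ((DefBy.self.comp ![0, 1, 0, 1]).congr fun v => by simp [BZ, abs_eq (Int.natCast_nonneg n)])
    exact DefBy.cooriented h0 DefBy.self hn (mem_algDiff_of_dvd hn hd) (mem_algDiff_of_dvd hn he)

theorem FarInvariant.defBy_BZ (h : FarInvariant R n N Eq) (hneg : ∀ x, R x → R (-x)) :
    DefBy (BZ n) R := by
  refine DefBy.of_finite
    (ι := smallMultiples n (k * N) × smallMultiples n (k * N) × Fin k × Fin k × Fin k × Fin k)
    (e := fun ⟨d, e, i, j, l, m⟩ v => Cooriented d e (v i - v j) (v l - v m))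
    (fun ⟨d, e, i, j, l, m⟩ => (defBy_BZ_cooriented d.2.1 e.2.1).comp₄
      (T := fun a b a' b' => Cooriented d e (a - b) (a' - b')) i j l m) fun x y hxy hx => ?_
  rcases exists_sign_of_cooriented (fun _ => neg_mem_smallMultiples)
    fun d hd e he i j l m => hxy (⟨d, hd⟩, ⟨e, he⟩, i, j, l, m) with hs | hs
  · exact (h.iff_of_small (fun i j hij => ((hs i j).1 hij).symm)
      fun i j hij => ((hs i j).2 hij).symm).1 hx
  · refine (h.iff_of_small (x := -x) (fun i j hij => ?_) fun i j hij => ?_).1 (hneg x hx)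
    · rw [Pi.neg_apply, Pi.neg_apply] at hij ⊢
      have := (hs i j).1 (by convert neg_mem_smallMultiples hij using 1; ring)
      omega
    · rw [Pi.neg_apply, Pi.neg_apply]
      have := (hs i j).2 hij
      omega

theorem FarInvariant.AZ_defBy (h : FarInvariant R n N Eq)
    (hco : ∀ d e : ℤ, (n : ℤ) ∣ d → (n : ℤ) ∣ e →
      DefBy R fun v : Fin 4 → ℤ => Cooriented d e (v 0 - v 1) (v 2 - v 3))
    {x : Fin k → ℤ} (hx : R x) (hx' : ¬ R (-x)) : DefBy R (AZ n) := by
  have hdef : DefBy R fun v : Fin 2 → ℤ => Cooriented n n (v 0 - v 1) (v 0 - v 1) ∧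
      ∃ y : Fin k → ℤ, (∀ (d : smallMultiples n (k * N)) (i j : Fin k),
        x i - x j = d ↔ Cooriented n d (v 0 - v 1) (y i - y j)) ∧ R y := by
    refine DefBy.and ((hco n n dvd_rfl dvd_rfl).comp ![0, 1, 0, 1])
      (DefBy.ex (DefBy.and (DefBy.all_index fun d => DefBy.all_index fun i =>
        DefBy.all_index fun j => (DefBy.const _).iff ?_) (DefBy.self.comp Sum.inr)))
    exact (hco n d dvd_rfl d.2.1).comp₄ (T := fun a b a' b' => Cooriented n d (a - b) (a' - b'))
      (Sum.inl 0) (Sum.inl 1) (Sum.inr i) (Sum.inr j)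
  refine hdef.congr fun v => ⟨?_, fun hv => ?_⟩
  · rintro ⟨h0, y, h1, hy⟩
    unfold AZ
    by_contra hne
    have h0' : v 0 - v 1 = -(n : ℤ) := by
      unfold Cooriented at h0
      omega
    unfold Cooriented at h1
    refine hx' ((h.iff_of_small (fun i j hij => ?_) fun i j hij => ?_).1 hy)
    · have := (h1 ⟨_, neg_mem_smallMultiples hij⟩ i j).2 (.inr ⟨h0', by simp⟩)
      simp only [Pi.neg_apply] at this ⊢
      omega
    · rw [Pi.neg_apply, Pi.neg_apply] at hij ⊢
      have := (h1 ⟨_, neg_mem_smallMultiples hij⟩ i j).1 (by simp only; ring)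
      simp only at this
      omega
  · unfold AZ at hv
    refine ⟨.inl ⟨hv, hv⟩, x, fun d i j => ⟨fun h => .inl ⟨hv, h⟩, ?_⟩, hx⟩
    rintro (h | h)
    · exact h.2
    · have hn0 : (n : ℤ) = 0 := by omega
      have := d.2.1
      rw [hn0, zero_dvd_iff] at this
      rw [h.2, this, neg_zero]

end Cases

/-- If a relation `R` on `ℤ` is definable in `⟨ℤ, '⟩` and is not identically true and not
identically false, then `R ≈ A_n`, `R ≈ B_n` or `R ≈ C_n` for some natural number `n`. -/
theorem classification_Z {k : ℕ} (R : (Fin k → ℤ) → Prop) (hR : DefinableBy succZ R)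
    (hnontrivT : ¬ ∀ v : Fin k → ℤ, R v) (hnontrivF : ¬ ∀ v : Fin k → ℤ, ¬ R v) :
    ∃ n : ℕ, DefEquiv R (AZ n) ∨ DefEquiv R (BZ n) ∨ DefEquiv R (CZ n) := by
  have hsucc : LocalRel succZ := by
    refine ⟨1, fun x y hxy hx => ?_⟩
    unfold succZ at hx ⊢
    rcases hxy 1 0 with h | ⟨h, -⟩
    · omega
    · rw [hx, add_sub_cancel_left] at h
      simp at h
  obtain ⟨N, hN⟩ := DefBy.localRel hsucc hR
  obtain ⟨a, ha⟩ := Int.subgroup_cyclic (algDiff R)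
  have hmem : ∀ d, d ∈ algDiff R ↔ (a.natAbs : ℤ) ∣ d := fun d => by
    rw [ha, ← AddSubgroup.zmultiples_eq_closure, Int.mem_zmultiples_iff, Int.natAbs_dvd]
  generalize a.natAbs = n at hmem
  have habs : ∀ {d : ℤ}, (n : ℤ) ∣ d → DefBy R fun v : Fin 2 → ℤ => |v 0 - v 1| = |d| :=
    fun h => DefBy.abs_sub_of_mem_algDiff ((hmem _).2 h)
  refine ⟨n, ?_⟩
  by_cases hfar : FarInvariant R n N fun a b => |a| = |b|
  · exact .inr (.inr ⟨(habs dvd_rfl).congr fun v => by simp [CZ], hfar.defBy_CZ⟩)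
  obtain ⟨P, x, y, hxy, hP, hrel, hx, hy, hRx, hRy⟩ : ∃ (P : Set (Fin k)) (x y : Fin k → ℤ),
      (∀ i ∉ P, y i = x i) ∧ (∀ a ∈ P, ∀ b ∈ P, (n : ℤ) ∣ x a - x b) ∧
      (∀ a ∈ P, ∀ b ∈ P, |x a - x b| = |y a - y b|) ∧
      (∀ a ∈ P, ∀ i ∉ P, (N : ℤ) < |x a - x i|) ∧
      (∀ a ∈ P, ∀ i ∉ P, (N : ℤ) < |y a - y i|) ∧ R x ∧ ¬ R y := by
    by_contra! hno
    refine hfar ⟨⟨fun _ => rfl, Eq.symm, Eq.trans⟩, id, fun {d} hd => ?_, (hmem _).1, hN _ _,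
      fun h1 h2 h3 h4 h5 h6 => hno _ _ _ h1 h2 h3 h4 h5 h6⟩
    exact ((habs hd).comp₂ (T := fun p q => |p - q| = |d|) 0 1).and
      (((habs hd).comp₂ (T := fun p q => |p - q| = |d|) 2 3)) |>.congr fun v =>
        and_congr_right fun h => by rw [h, eq_comm]
  obtain ⟨c, hc0, hc, hcdef⟩ := exists_cooriented hN hxy
    (fun a ha b hb => (hmem _).2 (hP a ha b hb)) hrel hx hy hRx hRy
  have hco : ∀ d e : ℤ, (n : ℤ) ∣ d → (n : ℤ) ∣ e →
      DefBy R fun v : Fin 4 → ℤ => Cooriented d e (v 0 - v 1) (v 2 - v 3) :=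
    fun d e hd he => DefBy.cooriented hc0 hcdef hc ((hmem d).2 hd) ((hmem e).2 he)
  have hfar : FarInvariant R n N Eq := by
    refine ⟨eq_equivalence, fun h => h ▸ rfl, fun {d} hd => ?_, (hmem _).1, hN _ _,
      fun h1 h2 h3 h4 h5 => hN _ _ (Sim.of_cluster h3 (fun i hi j hj => by
        rw [h1 i hi, h1 j hj]) h4 h5)⟩
    refine (hco d d hd hd).congr fun v => ?_
    rw [abs_eq_abs]
    unfold Cooriented
    omega
  by_cases hneg : ∀ x, R x → R (-x)
  · exact .inr (.inl ⟨hco n n dvd_rfl dvd_rfl, hfar.defBy_BZ hneg⟩)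
  · push Not at hneg
    obtain ⟨x, hx, hx'⟩ := hneg
    exact .inl ⟨hfar.AZ_defBy hco hx hx', hfar.defBy_AZ⟩
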